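/- arXiv:1610.07508 — 2 statements merged into one kernel-verified Lean document; each statement's English description precedes it below -/
import Mathlib

section
/- Let K be a compact Hausdorff space, and let u, v : K → [0,∞] be lower semicontinuous functions with max(u(x), v(x)) = ∞ for every x ∈ K. Define Ξ on signed regular Borel measures by Ξ(μ) = ∫u dμ⁻ + ∫v dμ⁺ if the total variation ‖μ‖ = 1, and Ξ(μ) = +∞ otherwise. Then Ξ is lower semicontinuous with respect to the weak* topology. -/
open scoped ENNReal
open MeasureTheory Filter Topology

/-- If `max u v = ∞`, the sets where `u` and `v` are bounded are separated by a continuous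
function. -/
lemma exists_continuousMap_one_sub_le {K : Type*} [TopologicalSpace K] [CompactSpace K]
    [T2Space K] {u v : K → ℝ≥0∞}
    (hu : LowerSemicontinuous u) (hv : LowerSemicontinuous v) (huv : ∀ x, u x ⊔ v x = ⊤)
    {c : ℝ} (hc : 0 < c) :
    ∃ f : C(K, ℝ), (∀ x, |f x| ≤ 1) ∧ (∀ x, ENNReal.ofReal (1 - f x) ≤ ENNReal.ofReal c * v x) ∧
      ∀ x, ENNReal.ofReal (1 + f x) ≤ ENNReal.ofReal c * u x := by
  have hbig : ∀ {r : ℝ≥0∞}, ¬ r ≤ ENNReal.ofReal (2 / c) →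
      ENNReal.ofReal 2 ≤ ENNReal.ofReal c * r := by
    intro r hr
    calc ENNReal.ofReal 2 = ENNReal.ofReal c * ENNReal.ofReal (2 / c) := by
          rw [← ENNReal.ofReal_mul hc.le, mul_div_cancel₀ _ hc.ne']
      _ ≤ _ := by gcongr; exact (not_le.1 hr).le
  obtain ⟨p, hp0, hp1, hp⟩ := exists_continuous_zero_one_of_isClosed
    (hu.isClosed_preimage (ENNReal.ofReal (2 / c)))
    (hv.isClosed_preimage (ENNReal.ofReal (2 / c)))
    (Set.disjoint_left.2 fun x hxu hxv => by
      have := huv x ▸ sup_le (Set.mem_Iic.1 hxu) (Set.mem_Iic.1 hxv)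
      exact ENNReal.ofReal_ne_top (top_le_iff.1 this))
  have hf : ∀ x, ((2 : ℝ) • p - 1) x = 2 * p x - 1 := fun x => by simp
  refine ⟨(2 : ℝ) • p - 1, fun x => ?_, fun x => ?_, fun x => ?_⟩
  · rw [hf, abs_le]
    constructor <;> linarith [(hp x).1, (hp x).2]
  · rw [hf]
    by_cases hx : v x ≤ ENNReal.ofReal (2 / c)
    · have : p x = 1 := hp1 hx
      norm_num [this]
    · exact (ENNReal.ofReal_le_ofReal (by linarith [(hp x).1])).trans (hbig hx)
  · rw [hf]
    by_cases hx : u x ≤ ENNReal.ofReal (2 / c)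
    · have : p x = 0 := hp0 hx
      norm_num [this]
    · exact (ENNReal.ofReal_le_ofReal (by linarith [(hp x).2])).trans (hbig hx)

lemma MeasureTheory.SignedMeasure.regular_posPart_and_negPart {K : Type*} [TopologicalSpace K]
    [T2Space K] [MeasurableSpace K] [BorelSpace K] {μ : SignedMeasure K}
    (h : μ.totalVariation.Regular) :
    μ.toJordanDecomposition.posPart.Regular ∧ μ.toJordanDecomposition.negPart.Regular := by
  obtain ⟨S, hS, hP, hN⟩ := μ.toJordanDecomposition.mutuallySingular
  have hPS : μ.totalVariation.restrict Sᶜ = μ.toJordanDecomposition.posPart := by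
    rw [SignedMeasure.totalVariation, Measure.restrict_add, Measure.restrict_eq_zero.2 hN,
      add_zero, Measure.restrict_eq_self_of_ae_mem]
    rw [ae_iff]
    simpa using hP
  have hNS : μ.totalVariation.restrict S = μ.toJordanDecomposition.negPart := by
    rw [SignedMeasure.totalVariation, Measure.restrict_add, Measure.restrict_eq_zero.2 hP,
      zero_add, Measure.restrict_eq_self_of_ae_mem]
    rw [ae_iff]
    exact hN
  exact ⟨hPS ▸ Measure.Regular.restrict_of_measure_ne_top (measure_ne_top _ _),
    hNS ▸ Measure.Regular.restrict_of_measure_ne_top (measure_ne_top _ _)⟩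

section Auxiliary

variable {K : Type*} [TopologicalSpace K] [CompactSpace K] [MeasurableSpace K] [BorelSpace K]

lemma ContinuousMap.integrable_of_isFiniteMeasure (μ : Measure K) [IsFiniteMeasure μ]
    (f : C(K, ℝ)) : Integrable f μ :=
  f.continuous.integrable_of_hasCompactSupport (HasCompactSupport.of_compactSpace f)

lemma ContinuousMap.integral_le_toReal_lintegral (μ : Measure K) [IsFiniteMeasure μ]
    (f : C(K, ℝ)) : ∫ x, f x ∂μ ≤ (∫⁻ x, ENNReal.ofReal (f x) ∂μ).toReal := by
  rw [integral_eq_lintegral_pos_part_sub_lintegral_neg_part (f.integrable_of_isFiniteMeasure μ)]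
  linarith [@ENNReal.toReal_nonneg (∫⁻ x, ENNReal.ofReal (-f x) ∂μ)]

lemma ContinuousMap.ofReal_integral_le_lintegral (μ : Measure K) [IsFiniteMeasure μ]
    (f : C(K, ℝ)) : ENNReal.ofReal (∫ x, f x ∂μ) ≤ ∫⁻ x, ENNReal.ofReal (f x) ∂μ :=
  (ENNReal.ofReal_le_ofReal (f.integral_le_toReal_lintegral μ)).trans ENNReal.ofReal_toReal_le

/-- The pairing of `φ` with `P - N` is at most `∫ u dN + ∫ v dP` when `-u ≤ φ ≤ v`. -/
lemma ofReal_integral_sub_integral_le (P N : Measure K) [IsFiniteMeasure P] [IsFiniteMeasure N]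
    {u v : K → ℝ≥0∞} (φ : C(K, ℝ)) (hv : ∀ x, ENNReal.ofReal (φ x) ≤ v x)
    (hu : ∀ x, ENNReal.ofReal (-φ x) ≤ u x) :
    ENNReal.ofReal (∫ x, φ x ∂P - ∫ x, φ x ∂N) ≤ ∫⁻ x, u x ∂N + ∫⁻ x, v x ∂P := by
  have hN : ENNReal.ofReal (-∫ x, φ x ∂N) ≤ ∫⁻ x, u x ∂N := by
    rw [← integral_neg]
    exact ((-φ).ofReal_integral_le_lintegral N).trans (lintegral_mono hu)
  have hP := (φ.ofReal_integral_le_lintegral P).trans (lintegral_mono hv)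
  rw [sub_eq_neg_add]
  exact ENNReal.ofReal_add_le.trans (add_le_add hN hP)

/-- The integral of a lower semicontinuous function is approximated from below by the integrals
of its continuous minorants. -/
lemma LowerSemicontinuous.exists_continuousMap_lt_lintegral [T2Space K] (μ : Measure K)
    [IsFiniteMeasure μ] [μ.WeaklyRegular] {v : K → ℝ≥0∞} (hv : LowerSemicontinuous v) {b : ℝ≥0∞}
    (hb : b < ∫⁻ x, v x ∂μ) :
    ∃ h : C(K, ℝ), (∀ x, 0 ≤ h x) ∧ (∀ x, ENNReal.ofReal (h x) ≤ v x) ∧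
      b < ∫⁻ x, ENNReal.ofReal (h x) ∂μ := by
  rw [lintegral_eq_nnreal] at hb
  simp only [lt_iSup_iff] at hb
  obtain ⟨s, hsv, hbs⟩ := hb
  rw [← SimpleFunc.lintegral_eq_lintegral] at hbs
  simp only [SimpleFunc.map_apply] at hbs
  obtain ⟨η, hη, hbη⟩ : ∃ η : ℝ≥0∞, 0 < η ∧ b + η < ∫⁻ x, (s x : ℝ≥0∞) ∂μ := by
    obtain ⟨r, hr, hbr⟩ := ENNReal.lt_iff_exists_add_pos_lt.1 hbs
    exact ⟨r, by exact_mod_cast hr, hbr⟩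
  have hs_top : ∫⁻ x, (s x : ℝ≥0∞) ∂μ ≠ ⊤ := by
    obtain ⟨C, hC⟩ := s.exists_forall_le
    refine ((lintegral_mono fun x => ENNReal.coe_le_coe.2 (hC x)).trans_lt ?_).ne
    rw [lintegral_const]
    exact ENNReal.mul_lt_top ENNReal.coe_lt_top (measure_lt_top μ _)
  obtain ⟨g, hgs, hg, hsg⟩ :=
    s.exists_upperSemicontinuous_le_lintegral_le hs_top (ENNReal.half_pos hη.ne').ne'
  obtain ⟨δ, hδ, hδη⟩ : ∃ δ : NNReal, 0 < δ ∧ δ * μ Set.univ < η / 2 :=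
    ENNReal.exists_nnreal_pos_mul_lt (measure_ne_top μ _) (ENNReal.half_pos hη.ne').ne'
  obtain ⟨h, hh⟩ := exists_continuous_forall_mem_convex_of_local_const
    (t := fun x => {r : ℝ | 0 ≤ r ∧ (g x : ℝ) ≤ r + δ ∧ ENNReal.ofReal r ≤ v x})
    (fun x => by
      refine Set.OrdConnected.convex ⟨fun a ha c hc r hr => ⟨ha.1.trans hr.1, ?_, ?_⟩⟩
      · linarith [ha.2.1, hr.1]
      · exact (ENNReal.ofReal_le_ofReal hr.2).trans hc.2.2)
    (fun x => by
      rcases lt_or_ge (g x) δ with hx | hx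
      · refine ⟨0, ?_⟩
        filter_upwards [hg x δ hx] with y hy
        refine ⟨le_rfl, ?_, by simp⟩
        rw [zero_add]
        exact_mod_cast hy.le
      · have hδ2 : (0 : ℝ) < δ := hδ
        have hx' : (δ : ℝ) ≤ g x := by exact_mod_cast hx
        have hlt : g x - δ / 2 < g x := tsub_lt_self (hδ.trans_le hx) (half_pos hδ)
        have hle : δ / 2 ≤ g x := (half_le_self hδ.le).trans hx
        refine ⟨((g x - δ / 2 : NNReal) : ℝ), ?_⟩
        have hgv : ((g x - δ / 2 : NNReal) : ℝ≥0∞) < v x :=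
          (ENNReal.coe_lt_coe.2 hlt).trans_le ((ENNReal.coe_le_coe.2 (hgs x)).trans (hsv x))
        filter_upwards [hg x (g x + δ / 2) (lt_add_of_pos_right _ (half_pos hδ)),
          hv x _ hgv] with y hy hy'
        refine ⟨NNReal.coe_nonneg _, ?_, ?_⟩
        · rw [NNReal.coe_sub hle]
          have : (g y : ℝ) < g x + δ / 2 := by exact_mod_cast hy
          push_cast
          linarith
        · rw [ENNReal.ofReal_coe_nnreal]
          exact hy'.le)
  refine ⟨h, fun x => (hh x).1, fun x => (hh x).2.2, ?_⟩
  have hgh : ∫⁻ x, (g x : ℝ≥0∞) ∂μ ≤ ∫⁻ x, ENNReal.ofReal (h x) ∂μ + η / 2 := by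
    calc ∫⁻ x, (g x : ℝ≥0∞) ∂μ ≤ ∫⁻ x, (ENNReal.ofReal (h x) + δ) ∂μ := by
          refine lintegral_mono fun x => ?_
          rw [← ENNReal.ofReal_coe_nnreal, ← ENNReal.ofReal_coe_nnreal (p := δ),
            ← ENNReal.ofReal_add (hh x).1 δ.coe_nonneg]
          exact ENNReal.ofReal_le_ofReal (hh x).2.1
      _ = ∫⁻ x, ENNReal.ofReal (h x) ∂μ + δ * μ Set.univ := by
          rw [lintegral_add_right _ measurable_const, lintegral_const]
      _ ≤ _ := by gcongr
  have hlt : b + η < ∫⁻ x, ENNReal.ofReal (h x) ∂μ + η := by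
    calc b + η < ∫⁻ x, (s x : ℝ≥0∞) ∂μ := hbη
      _ ≤ ∫⁻ x, ENNReal.ofReal (h x) ∂μ + η / 2 + η / 2 := hsg.trans (by gcongr)
      _ = _ := by rw [add_assoc, ENNReal.add_halves]
  exact lt_of_add_lt_add_right hlt

lemma LowerSemicontinuous.lintegral_eq_iSup_continuousMap [T2Space K] (μ : Measure K)
    [IsFiniteMeasure μ] [μ.WeaklyRegular] {v : K → ℝ≥0∞} (hv : LowerSemicontinuous v) :
    ∫⁻ x, v x ∂μ = ⨆ h : {h : C(K, ℝ) // (∀ x, 0 ≤ h x) ∧ ∀ x, ENNReal.ofReal (h x) ≤ v x},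
      ∫⁻ x, ENNReal.ofReal (h.1 x) ∂μ := by
  refine le_antisymm (le_of_forall_lt fun b hb => ?_)
    (iSup_le fun h => lintegral_mono h.2.2)
  obtain ⟨h, h0, hhv, hbh⟩ := hv.exists_continuousMap_lt_lintegral μ hb
  exact hbh.trans_le (le_iSup_of_le ⟨h, h0, hhv⟩ le_rfl)

/-- Mutually singular regular measures are almost separated by a continuous function. -/
lemma exists_continuousMap_separating [T2Space K] (P N : Measure K) [IsFiniteMeasure P]
    [IsFiniteMeasure N] [P.Regular] [N.Regular] (hPN : P ⟂ₘ N) {ε : ℝ} (hε : 0 < ε) :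
    ∃ p : C(K, ℝ), (∀ x, p x ∈ Set.Icc (0 : ℝ) 1) ∧
      ∫ x, (1 - p x) ∂P ≤ ε ∧ ∫ x, p x ∂N ≤ ε := by
  have hε' : ENNReal.ofReal ε ≠ 0 := by simpa using hε
  obtain ⟨S, hS, hPS, hNS⟩ := hPN
  obtain ⟨C, hCS, hC, hPC⟩ :=
    hS.compl.exists_isClosed_sdiff_lt (measure_ne_top P _) hε'
  obtain ⟨D, hDS, hD, hND⟩ := hS.exists_isClosed_sdiff_lt (measure_ne_top N _) hε'
  obtain ⟨p, hpD, hpC, hp⟩ := exists_continuous_zero_one_of_isClosed hD hC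
    (Set.disjoint_of_subset hDS hCS disjoint_compl_right)
  have key : ∀ (μ : Measure K) [IsFiniteMeasure μ] (q : C(K, ℝ)) (T E : Set K), IsClosed E →
      μ Tᶜ = 0 → μ (T \ E) < ENNReal.ofReal ε → (∀ x, q x ≤ 1) → (∀ x ∈ E, q x = 0) →
      ∫ x, q x ∂μ ≤ ε := by
    intro μ _ q T E hE hT hTE hq hqE
    refine (ENNReal.ofReal_le_ofReal_iff hε.le).1
      ((q.ofReal_integral_le_lintegral μ).trans ?_)
    calc ∫⁻ x, ENNReal.ofReal (q x) ∂μ ≤ ∫⁻ x, Eᶜ.indicator 1 x ∂μ := by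
          refine lintegral_mono fun x => ?_
          by_cases hx : x ∈ E
          · simp [hqE x hx]
          · simpa [hx] using hq x
      _ = μ Eᶜ := lintegral_indicator_one hE.measurableSet.compl
      _ ≤ μ (Tᶜ ∪ T \ E) := measure_mono fun x hx => by
          by_cases hxT : x ∈ T
          · exact Or.inr ⟨hxT, hx⟩
          · exact Or.inl hxT
      _ ≤ μ Tᶜ + μ (T \ E) := measure_union_le _ _
      _ ≤ ENNReal.ofReal ε := by rw [hT, zero_add]; exact hTE.le
  refine ⟨p, hp, key P (1 - p) Sᶜ C hC (by rwa [compl_compl]) hPC ?_ ?_,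
    key N p S D hD hNS hND (fun x => (hp x).2) fun x hx => hpD hx⟩
  · intro x
    simpa using (hp x).1
  · intro x hx
    simp [hpC hx]

/-- For mutually singular regular measures, `∫ u dN + ∫ v dP` is approximated by the pairings of
`P - N` with continuous functions between `-u` and `v`. -/
lemma exists_continuousMap_lt_integral_sub [T2Space K] (P N : Measure K) [IsFiniteMeasure P]
    [IsFiniteMeasure N] [P.Regular] [N.Regular] (hPN : P ⟂ₘ N) {u v : K → ℝ≥0∞}
    (hu : LowerSemicontinuous u) (hv : LowerSemicontinuous v) {a : ℝ≥0∞}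
    (ha : a < ∫⁻ x, u x ∂N + ∫⁻ x, v x ∂P) :
    ∃ φ : C(K, ℝ), (∀ x, ENNReal.ofReal (φ x) ≤ v x) ∧ (∀ x, ENNReal.ofReal (-φ x) ≤ u x) ∧
      a.toReal < ∫ x, φ x ∂P - ∫ x, φ x ∂N := by
  have : ∀ w : K → ℝ≥0∞,
      Nonempty {h : C(K, ℝ) // (∀ x, 0 ≤ h x) ∧ ∀ x, ENNReal.ofReal (h x) ≤ w x} :=
    fun w => ⟨0, by simp, by simp⟩
  rw [hu.lintegral_eq_iSup_continuousMap N, hv.lintegral_eq_iSup_continuousMap P,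
    ENNReal.iSup_add] at ha
  simp only [ENNReal.add_iSup, lt_iSup_iff] at ha
  obtain ⟨⟨g, hg0, hgu⟩, ⟨h, hh0, hhv⟩, ha⟩ := ha
  have hgN := g.integrable_of_isFiniteMeasure N
  have hhP := h.integrable_of_isFiniteMeasure P
  have ha' : a.toReal < ∫ x, g x ∂N + ∫ x, h x ∂P := by
    rw [← ofReal_integral_eq_lintegral_ofReal hgN (ae_of_all _ hg0),
      ← ofReal_integral_eq_lintegral_ofReal hhP (ae_of_all _ hh0),
      ← ENNReal.ofReal_add (integral_nonneg hg0) (integral_nonneg hh0)] at ha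
    exact (ENNReal.lt_ofReal_iff_toReal_lt ha.ne_top).1 ha
  set M : ℝ := ‖h + g‖
  have hMx : ∀ x, h x + g x ≤ M := fun x => (le_abs_self _).trans ((h + g).norm_coe_le_norm x)
  have hM0 : 0 ≤ M := norm_nonneg _
  obtain ⟨ε, hε, hMε⟩ := exists_pos_mul_lt (sub_pos.2 ha') (2 * M)
  obtain ⟨p, hp, hpP, hpN⟩ := exists_continuousMap_separating P N hPN hε
  refine ⟨p * h - (1 - p) * g, fun x => ?_, fun x => ?_, ?_⟩
  · refine (ENNReal.ofReal_le_ofReal ?_).trans (hhv x)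
    simp only [ContinuousMap.sub_apply, ContinuousMap.mul_apply, ContinuousMap.one_apply]
    nlinarith [hp x |>.1, hp x |>.2, hg0 x, hh0 x]
  · refine (ENNReal.ofReal_le_ofReal ?_).trans (hgu x)
    simp only [ContinuousMap.sub_apply, ContinuousMap.mul_apply, ContinuousMap.one_apply]
    nlinarith [hp x |>.1, hp x |>.2, hg0 x, hh0 x]
  · set φ : C(K, ℝ) := p * h - (1 - p) * g with hφ
    have hP : ∫ x, h x ∂P - M * ∫ x, (1 - p x) ∂P ≤ ∫ x, φ x ∂P := by
      rw [← integral_const_mul, ← integral_sub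
        (f := h) (g := fun x => M * (1 - p x)) hhP
        (((1 - p).integrable_of_isFiniteMeasure P).const_mul M)]
      refine integral_mono ((h - M • (1 - p)).integrable_of_isFiniteMeasure P)
        (φ.integrable_of_isFiniteMeasure P) fun x => ?_
      simp only [hφ, ContinuousMap.sub_apply, ContinuousMap.mul_apply, ContinuousMap.one_apply]
      nlinarith [mul_le_mul_of_nonneg_left (hMx x) (sub_nonneg.2 (hp x).2)]
    have hN : ∫ x, φ x ∂N ≤ M * ∫ x, p x ∂N - ∫ x, g x ∂N := by
      rw [← integral_const_mul, ← integral_sub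
        ((p.integrable_of_isFiniteMeasure N).const_mul M) hgN]
      refine integral_mono (φ.integrable_of_isFiniteMeasure N)
        ((M • p - g).integrable_of_isFiniteMeasure N) fun x => ?_
      simp only [hφ, ContinuousMap.sub_apply, ContinuousMap.mul_apply, ContinuousMap.one_apply]
      nlinarith [mul_le_mul_of_nonneg_left (hMx x) (hp x).1]
    nlinarith [mul_le_mul_of_nonneg_left hpP hM0, mul_le_mul_of_nonneg_left hpN hM0]

/-- The pairing of `P - N` with a function as in `exists_continuousMap_one_sub_le` is close to
the total mass. -/
lemma measureReal_add_sub_le (P N : Measure K) [IsFiniteMeasure P] [IsFiniteMeasure N]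
    {u v : K → ℝ≥0∞} {c : ℝ} {a : ℝ≥0∞} (ha : a ≠ ⊤)
    (hle : ∫⁻ x, u x ∂N + ∫⁻ x, v x ∂P ≤ a) (hc : 0 ≤ c) {f : C(K, ℝ)}
    (hfv : ∀ x, ENNReal.ofReal (1 - f x) ≤ ENNReal.ofReal c * v x)
    (hfu : ∀ x, ENNReal.ofReal (1 + f x) ≤ ENNReal.ofReal c * u x) :
    P.real Set.univ + N.real Set.univ - (∫ x, f x ∂P - ∫ x, f x ∂N) ≤ c * a.toReal := by
  have hP : ∫ x, (1 - f) x ∂P = P.real Set.univ - ∫ x, f x ∂P := by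
    have := integral_sub (integrable_const (μ := P) (1 : ℝ)) (f.integrable_of_isFiniteMeasure P)
    simpa using this
  have hN : ∫ x, (1 + f) x ∂N = N.real Set.univ + ∫ x, f x ∂N := by
    have := integral_add (integrable_const (μ := N) (1 : ℝ)) (f.integrable_of_isFiniteMeasure N)
    simpa using this
  have key : ENNReal.ofReal (∫ x, (1 + f) x ∂N + ∫ x, (1 - f) x ∂P) ≤
      ENNReal.ofReal (c * a.toReal) := by
    calc _ ≤ _ := ENNReal.ofReal_add_le
      _ ≤ ∫⁻ x, ENNReal.ofReal c * u x ∂N + ∫⁻ x, ENNReal.ofReal c * v x ∂P :=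
          add_le_add (((1 + f).ofReal_integral_le_lintegral N).trans (lintegral_mono hfu))
            (((1 - f).ofReal_integral_le_lintegral P).trans (lintegral_mono hfv))
      _ ≤ ENNReal.ofReal c * a := by
          rw [lintegral_const_mul' _ _ ENNReal.ofReal_ne_top,
            lintegral_const_mul' _ _ ENNReal.ofReal_ne_top, ← mul_add]
          gcongr
      _ = _ := by rw [ENNReal.ofReal_mul hc, ENNReal.ofReal_toReal ha]
  have := (ENNReal.ofReal_le_ofReal_iff (by positivity)).1 key
  rw [hP, hN] at this
  linarith

end Auxiliary

/-- The function `Ξ(μ) = ∫u dμ⁻ + ∫v dμ⁺` if `‖μ‖ = 1`, `+∞` otherwise, is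
lower semicontinuous on the regular signed Borel measures with the weak*
topology (induced by pairing with continuous functions). -/
theorem Xi_lowerSemicontinuous_weakStar {K : Type*} [TopologicalSpace K]
    [CompactSpace K] [T2Space K] [MeasurableSpace K] [BorelSpace K]
    (u v : K → ℝ≥0∞) (hu : LowerSemicontinuous u) (hv : LowerSemicontinuous v)
    (huv : ∀ x, u x ⊔ v x = ⊤) :
    letI : TopologicalSpace {μ : SignedMeasure K // μ.totalVariation.Regular} :=
      TopologicalSpace.induced
        (fun μ : {μ : SignedMeasure K // μ.totalVariation.Regular} =>
          fun f : C(K, ℝ) =>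
            ∫ x, f x ∂μ.1.toJordanDecomposition.posPart
              - ∫ x, f x ∂μ.1.toJordanDecomposition.negPart)
        Pi.topologicalSpace
    LowerSemicontinuous
      (fun μ : {μ : SignedMeasure K // μ.totalVariation.Regular} =>
        if μ.1.totalVariation Set.univ = 1 then
          ∫⁻ x, u x ∂μ.1.toJordanDecomposition.negPart
            + ∫⁻ x, v x ∂μ.1.toJordanDecomposition.posPart
        else (⊤ : ℝ≥0∞)) := by
  let T (f : C(K, ℝ)) (μ : {μ : SignedMeasure K // μ.totalVariation.Regular}) : ℝ :=
    ∫ x, f x ∂μ.1.toJordanDecomposition.posPart - ∫ x, f x ∂μ.1.toJordanDecomposition.negPart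
  let _ : TopologicalSpace {μ : SignedMeasure K // μ.totalVariation.Regular} :=
    TopologicalSpace.induced (fun μ f => T f μ) Pi.topologicalSpace
  have hT : ∀ f, Continuous (T f) := fun f =>
    continuous_pi_iff.1 (continuous_induced_dom (f := fun μ f => T f μ)) f
  have hlsc : ∀ {u v : K → ℝ≥0∞}, LowerSemicontinuous u → LowerSemicontinuous v →
      LowerSemicontinuous fun μ : {μ : SignedMeasure K // μ.totalVariation.Regular} =>
        ∫⁻ x, u x ∂μ.1.toJordanDecomposition.negPart
          + ∫⁻ x, v x ∂μ.1.toJordanDecomposition.posPart := by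
    intro u v hu hv μ₀ a ha
    obtain ⟨_, _⟩ := SignedMeasure.regular_posPart_and_negPart μ₀.2
    obtain ⟨φ, hφv, hφu, hφ⟩ := exists_continuousMap_lt_integral_sub _ _
      μ₀.1.toJordanDecomposition.mutuallySingular hu hv ha
    filter_upwards [(hT φ).continuousAt.eventually_const_lt hφ] with μ hμ
    exact ((ENNReal.lt_ofReal_iff_toReal_lt ha.ne_top).2 hμ).trans_le
      (ofReal_integral_sub_integral_le _ _ φ hφv hφu)
  intro μ₀ a ha
  have ha_top : a ≠ ⊤ := ha.ne_top
  rcases lt_trichotomy (μ₀.1.totalVariation Set.univ) 1 with h | h | h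
  · set P₀ := μ₀.1.toJordanDecomposition.posPart
    set N₀ := μ₀.1.toJordanDecomposition.negPart
    have hm : P₀.real Set.univ + N₀.real Set.univ < 1 := by
      rw [SignedMeasure.totalVariation, Measure.add_apply] at h
      rw [measureReal_def, measureReal_def,
        ← ENNReal.toReal_add (measure_ne_top _ _) (measure_ne_top _ _)]
      exact (ENNReal.toReal_lt_toReal
        (ENNReal.add_ne_top.2 ⟨measure_ne_top _ _, measure_ne_top _ _⟩) ENNReal.one_ne_top).2 h
    obtain ⟨c, hc, hca⟩ := exists_pos_mul_lt (sub_pos.2 hm) a.toReal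
    obtain ⟨f, hf1, hfv, hfu⟩ := exists_continuousMap_one_sub_le hu hv huv hc
    have hTf : T f μ₀ ≤ P₀.real Set.univ + N₀.real Set.univ := by
      have hP : |∫ x, f x ∂P₀| ≤ 1 * P₀.real Set.univ :=
        norm_integral_le_of_norm_le_const (f := f) (ae_of_all _ hf1)
      have hN : |∫ x, f x ∂N₀| ≤ 1 * N₀.real Set.univ :=
        norm_integral_le_of_norm_le_const (f := f) (ae_of_all _ hf1)
      simp only [T]
      linarith [le_abs_self (∫ x, f x ∂P₀), neg_le_abs (∫ x, f x ∂N₀)]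
    have hlt : T f μ₀ < 1 - c * a.toReal := by linarith
    filter_upwards [(hT f).continuousAt.eventually_lt_const hlt] with μ hμ
    split_ifs with h1
    · by_contra! hle
      have := measureReal_add_sub_le _ _ ha_top hle hc.le hfv hfu
      rw [SignedMeasure.totalVariation, Measure.add_apply] at h1
      rw [measureReal_def, measureReal_def,
        ← ENNReal.toReal_add (measure_ne_top _ _) (measure_ne_top _ _), h1,
        ENNReal.toReal_one] at this
      simp only [T] at hμ
      linarith
    · exact ha_top.lt_top
  · simp only [h, if_true] at ha
    filter_upwards [hlsc hu hv μ₀ a ha] with μ hμ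
    split_ifs
    · exact hμ
    · exact ha_top.lt_top
  · have h1 := hlsc (u := fun _ => 1) (v := fun _ => 1) lowerSemicontinuous_const
      lowerSemicontinuous_const μ₀ 1 (by
        simpa [SignedMeasure.totalVariation, add_comm] using h)
    filter_upwards [h1] with μ hμ
    rw [if_neg]
    · exact ha_top.lt_top
    · intro h
      rw [SignedMeasure.totalVariation, Measure.add_apply] at h
      simp only [lintegral_const, one_mul] at hμ
      rw [add_comm, h] at hμ
      exact lt_irrefl _ hμ
end

section
/- Let K be a compact Hausdorff space and u, v : K → [0,∞] lower semicontinuous functions with max(u(x), v(x)) = ∞ for all x. Then the function Ξ on signed regular Borel measures, defined by Ξ(μ) = ∫u dμ⁻ + ∫v dμ⁺ when ‖μ‖ = 1 and +∞ otherwise, is affine on the closed unit ball of the dual of C(K): if μ = (1−λ)μ₁ + λμ₂ with μ, μ₁, μ₂ in the unit ball and λ ∈ (0,1), then Ξ(μ) = (1−λ)Ξ(μ₁) + λΞ(μ₂) (with values in [0,∞]). -/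
open scoped ENNReal
open MeasureTheory

/-- `Ξ(μ) = ∫u dμ⁻ + ∫v dμ⁺` if `‖μ‖ = 1`, `+∞` otherwise. -/
noncomputable def Xi {K : Type*} [TopologicalSpace K] [MeasurableSpace K]
    (u v : K → ℝ≥0∞) (μ : SignedMeasure K) : ℝ≥0∞ :=
  if μ.totalVariation Set.univ = 1 then
    ∫⁻ x, u x ∂μ.toJordanDecomposition.negPart
      + ∫⁻ x, v x ∂μ.toJordanDecomposition.posPart
  else ⊤

/-- A signed measure written as a difference of mutually singular finite measures has those
measures as its Jordan decomposition. -/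
theorem toJordanDecomposition_sub_of_mutuallySingular {α : Type*} [MeasurableSpace α]
    {m n : Measure α} [IsFiniteMeasure m] [IsFiniteMeasure n] (hmn : m ⟂ₘ n) :
    (m.toSignedMeasure - n.toSignedMeasure).toJordanDecomposition = ⟨m, n, hmn⟩ :=
  SignedMeasure.toJordanDecomposition_eq rfl

/-- If the total mass of two finite measures does not exceed the total variation of their
difference, then they are mutually singular. -/
theorem mutuallySingular_of_le_totalVariation_sub {α : Type*} [MeasurableSpace α]
    {m n : Measure α} [IsFiniteMeasure m] [IsFiniteMeasure n]
    (h : m Set.univ + n Set.univ ≤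
      (m.toSignedMeasure - n.toSignedMeasure).totalVariation Set.univ) : m ⟂ₘ n := by
  set s := m.toSignedMeasure - n.toSignedMeasure with hs
  set p := s.toJordanDecomposition.posPart
  set q := s.toJordanDecomposition.negPart
  obtain ⟨S, hS, hpS, hqS⟩ := s.toJordanDecomposition.mutuallySingular
  have hsub : ∀ A, MeasurableSet A → m.real A - n.real A = p.real A - q.real A := by
    intro A hA
    rw [← s.apply_eq_posPart_real_sub_negPart_real hA, hs]
    simp [Measure.toSignedMeasure_apply, hA]
  have e₁ := hsub S hS
  have e₂ := hsub Sᶜ hS.compl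
  have hp : p.real S = 0 := by simp [Measure.real, p, hpS]
  have hq : q.real Sᶜ = 0 := by simp [Measure.real, q, hqS]
  have hle : m.real Set.univ + n.real Set.univ ≤ p.real Set.univ + q.real Set.univ := by
    have := ENNReal.toReal_mono (by finiteness) h
    rw [ENNReal.toReal_add (by finiteness) (by finiteness), SignedMeasure.totalVariation,
      Measure.add_apply, ENNReal.toReal_add (by finiteness) (by finiteness)] at this
    exact this
  rw [← measureReal_add_measureReal_compl (μ := m) hS,
    ← measureReal_add_measureReal_compl (μ := n) hS,
    ← measureReal_add_measureReal_compl (μ := p) hS,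
    ← measureReal_add_measureReal_compl (μ := q) hS] at hle
  have hmS : 0 ≤ m.real S := measureReal_nonneg
  have hnS : 0 ≤ n.real Sᶜ := measureReal_nonneg
  exact ⟨S, hS, (measureReal_eq_zero_iff).1 (by linarith),
    (measureReal_eq_zero_iff).1 (by linarith)⟩

/-- Two measures are mutually singular if they integrate to finite values two functions whose
maximum is infinite everywhere. -/
theorem mutuallySingular_of_lintegral_ne_top {α : Type*} [MeasurableSpace α]
    {m n : Measure α} {u v : α → ℝ≥0∞} (hu : Measurable u) (hv : Measurable v)
    (huv : ∀ x, u x ⊔ v x = ⊤) (hun : ∫⁻ x, u x ∂n ≠ ⊤) (hvm : ∫⁻ x, v x ∂m ≠ ⊤) :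
    m ⟂ₘ n := by
  refine ⟨{x | v x = ⊤}, hv (measurableSet_singleton ⊤), ?_, ?_⟩
  · simpa [ae_iff] using ae_lt_top hv hvm
  · refine measure_mono_null (fun x hx ↦ ?_) (ae_lt_top hu hun)
    have := huv x
    simp_all [max_eq_top]

/-- If a convex combination of two extended nonnegative reals bounded by `1` equals `1`, and the
first weight is positive, then the first of them equals `1`. -/
theorem eq_one_of_convex_combination_eq_one {s t x y : ℝ≥0∞} (hs : s ≠ 0) (hst : s + t = 1)
    (hx : x ≤ 1) (hy : y ≤ 1) (hxy : s * x + t * y = 1) : x = 1 := by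
  have hs_top : s ≠ ⊤ := by rintro rfl; simp at hst
  have ht_top : t ≠ ⊤ := by rintro rfl; simp at hst
  by_contra hx1
  have hlt : s * x < s * 1 := ENNReal.mul_lt_mul_right hs hs_top (lt_of_le_of_ne hx hx1)
  have hle : t * y ≤ t * 1 := by gcongr
  have := ENNReal.add_lt_add_of_lt_of_le (ne_top_of_le_ne_top (by finiteness) hle) hlt hle
  simp [hst, hxy] at this

/-- `Ξ` is affine on the closed unit ball of the dual of `C(K)`. -/
theorem Xi_affine_on_unit_ball {K : Type*} [TopologicalSpace K]
    [CompactSpace K] [T2Space K] [MeasurableSpace K] [BorelSpace K]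
    (u v : K → ℝ≥0∞) (hu : LowerSemicontinuous u) (hv : LowerSemicontinuous v)
    (huv : ∀ x, u x ⊔ v x = ⊤)
    (μ μ₁ μ₂ : SignedMeasure K)
    (hreg : μ.totalVariation.Regular) (hreg₁ : μ₁.totalVariation.Regular)
    (hreg₂ : μ₂.totalVariation.Regular)
    (h : μ.totalVariation Set.univ ≤ 1)
    (h₁ : μ₁.totalVariation Set.univ ≤ 1) (h₂ : μ₂.totalVariation Set.univ ≤ 1)
    (l : ℝ) (hl : l ∈ Set.Ioo (0 : ℝ) 1)
    (hμ : μ = (1 - l) • μ₁ + l • μ₂) :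
    Xi u v μ = ENNReal.ofReal (1 - l) * Xi u v μ₁ + ENNReal.ofReal l * Xi u v μ₂ := by
  obtain ⟨hl0, hl1⟩ := hl
  lift l to NNReal using hl0.le with b
  obtain ⟨a, ha⟩ : ∃ a : NNReal, (a : ℝ) = 1 - b := ⟨⟨1 - b, by linarith⟩, rfl⟩
  rw [← ha] at hμ ⊢
  have ha0 : (a : ℝ≥0∞) ≠ 0 := by
    rw [ENNReal.coe_ne_zero, ← NNReal.coe_ne_zero]; linarith
  have hb0 : (b : ℝ≥0∞) ≠ 0 := by
    rw [ENNReal.coe_ne_zero, ← NNReal.coe_ne_zero]; linarith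
  have hab : (a : ℝ≥0∞) + b = 1 := by
    rw [← ENNReal.coe_add, ENNReal.coe_eq_one, ← NNReal.coe_eq_one, NNReal.coe_add]; linarith
  rw [ENNReal.ofReal_coe_nnreal, ENNReal.ofReal_coe_nnreal]
  set p₁ := μ₁.toJordanDecomposition.posPart
  set q₁ := μ₁.toJordanDecomposition.negPart
  set p₂ := μ₂.toJordanDecomposition.posPart
  set q₂ := μ₂.toJordanDecomposition.negPart
  set m := a • p₁ + b • p₂ with hm
  set n := a • q₁ + b • q₂ with hn
  have hμmn : μ = m.toSignedMeasure - n.toSignedMeasure := by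
    ext A hA
    rw [hμ, Measure.toSignedMeasure_sub_apply hA, hm, hn,
      measureReal_add_apply, measureReal_add_apply]
    simp only [_root_.add_apply, _root_.smul_apply, smul_eq_mul,
      measureReal_nnreal_smul_apply, μ₁.apply_eq_posPart_real_sub_negPart_real hA,
      μ₂.apply_eq_posPart_real_sub_negPart_real hA]
    ring
  have hmass : m Set.univ + n Set.univ =
      a * μ₁.totalVariation Set.univ + b * μ₂.totalVariation Set.univ := by
    simp only [SignedMeasure.totalVariation, hm, hn, Measure.add_apply, Measure.smul_apply,
      ENNReal.smul_def, smul_eq_mul]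
    ring
  have hmass_le : m Set.univ + n Set.univ ≤ 1 := by
    rw [hmass, ← hab]
    gcongr <;> exact mul_le_of_le_one_right' ‹_›
  have hint : (∫⁻ x, u x ∂n) + ∫⁻ x, v x ∂m =
      a * (∫⁻ x, u x ∂q₁ + ∫⁻ x, v x ∂p₁) + b * (∫⁻ x, u x ∂q₂ + ∫⁻ x, v x ∂p₂) := by
    simp only [hm, hn, lintegral_add_measure, lintegral_smul_measure, ENNReal.smul_def,
      smul_eq_mul]
    ring
  have hXi_of_ne : ∀ ν : SignedMeasure K, ν.totalVariation Set.univ ≠ 1 → Xi u v ν = ⊤ :=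
    fun ν hν ↦ if_neg hν
  have htv : ∀ hmn : m ⟂ₘ n, μ.totalVariation Set.univ = m Set.univ + n Set.univ := by
    intro hmn
    rw [hμmn, SignedMeasure.totalVariation, toJordanDecomposition_sub_of_mutuallySingular hmn,
      Measure.add_apply]
  by_cases hμ1 : μ.totalVariation Set.univ = 1
  · have hmn : m ⟂ₘ n := mutuallySingular_of_le_totalVariation_sub (by
      rwa [← hμmn, hμ1])
    rw [htv hmn, hmass] at hμ1
    have e₁ := eq_one_of_convex_combination_eq_one ha0 hab h₁ h₂ hμ1
    have e₂ := eq_one_of_convex_combination_eq_one hb0 ((add_comm _ _).trans hab) h₂ h₁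
      ((add_comm _ _).trans hμ1)
    rw [Xi, if_pos (by rw [htv hmn, hmass, hμ1]), Xi, if_pos e₁, Xi, if_pos e₂, ← hint, hμmn,
      toJordanDecomposition_sub_of_mutuallySingular hmn]
  · rw [hXi_of_ne μ hμ1]
    by_cases e₁ : μ₁.totalVariation Set.univ = 1
    swap
    · simp [hXi_of_ne μ₁ e₁, ENNReal.mul_top ha0]
    by_cases e₂ : μ₂.totalVariation Set.univ = 1
    swap
    · simp [hXi_of_ne μ₂ e₂, ENNReal.mul_top hb0]
    rw [Xi, if_pos e₁, Xi, if_pos e₂, ← hint]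
    by_contra hfin
    have hfin' := ENNReal.add_ne_top.1 (Ne.symm hfin)
    have hmn : m ⟂ₘ n :=
      mutuallySingular_of_lintegral_ne_top hu.measurable hv.measurable huv hfin'.1 hfin'.2
    exact hμ1 (by rw [htv hmn, hmass, e₁, e₂, mul_one, mul_one, hab])
end
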